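/- Let K be an algebraically closed field of characteristic zero, let φ ∈ K[z] be a polynomial of degree d ≥ 2, and let M ≥ 0 and N ≥ 1 be integers. If φ is not linearly conjugate to z² - 3/4, then there exists x ∈ K with portrait (M,N) under φ. If φ is linearly conjugate to z² - 3/4, then there exists a point with portrait (M,N) under φ if and only if N ≠ 2. -/

import Mathlib

open Function Polynomial

/-- `x` has (exact) preperiodic portrait `(M, N)` under the self-map `φ`. -/
def Portrait {K : Type*} (φ : K → K) (x : K) (M N : ℕ) : Prop :=
  0 < N ∧ φ^[M + N] x = φ^[M] x ∧
    (∀ m n : ℕ, 0 < n → φ^[m + n] x = φ^[m] x → M ≤ m) ∧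
    (∀ n : ℕ, 0 < n → φ^[M + n] x = φ^[M] x → N ≤ n)

/-- `φ` and `ψ` are linearly conjugate: there is a linear `ℓ(z) = a z + b` (with `a ≠ 0`)
such that `ψ = ℓ⁻¹ ∘ φ ∘ ℓ`, i.e. `ℓ ∘ ψ = φ ∘ ℓ` as functions. -/
def LinConj {K : Type*} [Field K] (φ ψ : Polynomial K) : Prop :=
  ∃ a b : K, a ≠ 0 ∧ ∀ z : K, a * ψ.eval z + b = φ.eval (a * z + b)

lemma bk_exists_G {K : Type*} [Field K] [IsAlgClosed K] [DecidableEq K] (A : K[X]) (_hA : A ≠ 0) :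
    ∃ G : K[X], G ≠ 0 ∧ G ∣ A ∧ G ∣ derivative A ∧
      A.natDegree ≤ G.natDegree + A.roots.toFinset.card := by
  have hd : ∀ a : K, (X - C a) ^ (A.roots.count a) ∣ A := by
    intro a
    rw [count_roots]
    exact pow_rootMultiplicity_dvd A a
  have hco : (↑A.roots.toFinset : Set K).Pairwise
      (Function.onFun IsCoprime fun a : K => (X - C a) ^ (A.roots.count a - 1)) := by
    intro a _ b _ hab
    exact ((pairwise_coprime_X_sub_C (s := (id : K → K)) injective_id) hab).pow
  refine ⟨∏ a ∈ A.roots.toFinset, (X - C a) ^ (A.roots.count a - 1), ?_, ?_, ?_, ?_⟩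
  · exact Finset.prod_ne_zero_iff.mpr fun a _ => pow_ne_zero _ (X_sub_C_ne_zero a)
  · exact Finset.prod_dvd_of_coprime hco fun a _ =>
      (pow_dvd_pow _ (Nat.sub_le _ _)).trans (hd a)
  · exact Finset.prod_dvd_of_coprime hco fun a _ =>
      pow_sub_one_dvd_derivative_of_pow_dvd (hd a)
  · rw [natDegree_prod _ _ fun a _ => pow_ne_zero _ (X_sub_C_ne_zero a)]
    simp only [natDegree_pow, natDegree_X_sub_C, mul_one]
    rw [(IsAlgClosed.splits A).natDegree_eq_card_roots, ← Multiset.toFinset_sum_count_eq,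
      Finset.card_eq_sum_ones, ← Finset.sum_add_distrib]
    exact Finset.sum_le_sum fun a _ => by omega

lemma bk_W {K : Type*} [Field K] [CharZero K] (A : K[X]) (hA : 2 ≤ A.natDegree) (a : K) :
    (derivative A * (X - C a) - A).natDegree = A.natDegree ∧
    (derivative A * (X - C a) - A).leadingCoeff = ((A.natDegree : K) - 1) * A.leadingCoeff := by
  have hle : (derivative A * (X - C a) - A).natDegree ≤ A.natDegree := by
    refine (natDegree_sub_le _ _).trans (max_le ?_ le_rfl)
    refine natDegree_mul_le.trans ?_
    rw [natDegree_X_sub_C]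
    have := natDegree_derivative_lt (p := A) (by omega)
    omega
  have hc : (derivative A * (X - C a) - A).coeff A.natDegree
      = ((A.natDegree : K) - 1) * A.leadingCoeff := by
    obtain ⟨m, hm⟩ : ∃ m, A.natDegree = m + 1 := ⟨A.natDegree - 1, by omega⟩
    have h2 : A.coeff (m + 1 + 1) = 0 := coeff_eq_zero_of_natDegree_lt (by omega)
    rw [leadingCoeff, hm, coeff_sub, coeff_mul_X_sub_C, coeff_derivative, coeff_derivative, h2]
    push_cast
    ring
  have hA0 : A ≠ 0 := by rintro rfl; simp at hA
  have hne : ((A.natDegree : K) - 1) * A.leadingCoeff ≠ 0 := by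
    refine mul_ne_zero ?_ (leadingCoeff_ne_zero.mpr hA0)
    rw [sub_ne_zero]
    exact_mod_cast (by omega : A.natDegree ≠ 1)
  have hdeg : (derivative A * (X - C a) - A).natDegree = A.natDegree :=
    le_antisymm hle (le_natDegree_of_ne_zero (by rw [hc]; exact hne))
  exact ⟨hdeg, by rw [leadingCoeff, hdeg, hc]⟩

/-- the divisibility at the heart of the argument -/
lemma bk_key {K : Type*} [Field K] (Q G B : K[X]) (a : K)
    (hG : G ∣ Q - X) (hG' : G ∣ derivative (Q - X)) (hB : B ∣ Q - C a) (hB' : B ∣ derivative Q) :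
    G * B ∣ derivative (Q - X) * (X - C a) - (Q - X) := by
  have hco : IsCoprime G B := by
    obtain ⟨u, hu⟩ := hG'
    obtain ⟨v, hv⟩ := hB'
    refine ⟨-u, v, ?_⟩
    rw [mul_comm, mul_neg, ← hu, mul_comm v, ← hv]
    simp
  refine hco.mul_dvd ?_ ?_
  · exact dvd_sub (hG'.mul_right _) hG
  · have : derivative (Q - X) * (X - C a) - (Q - X) = derivative Q * (X - C a) - (Q - C a) := by
      simp only [derivative_sub, derivative_X]; ring
    rw [this]
    exact dvd_sub (hB'.mul_right _) hB

lemma bk_comp_dvd {K : Type*} [Field K] (φ R S : K[X]) (c : K) (h1 : S ∣ φ - C (φ.eval c))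
    (h2 : S ∣ derivative φ) :
    S.comp R ∣ φ.comp R - C (φ.eval c) ∧ S.comp R ∣ derivative (φ.comp R) := by
  constructor
  · obtain ⟨T, hT⟩ := h1
    refine ⟨T.comp R, ?_⟩
    rw [← mul_comp, ← hT]; simp
  · obtain ⟨T, hT⟩ := h2
    rw [derivative_comp, hT, mul_comp]
    exact Dvd.intro _ (by ring : S.comp R * (derivative R * T.comp R) = _)

lemma bk_it {K : Type*} [Field K] (φ : K[X]) (n : ℕ) :
    (φ.comp^[n] X).natDegree = φ.natDegree ^ n := by
  rw [natDegree_iterate_comp]; simp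

lemma bk_itA {K : Type*} [Field K] (φ : K[X]) (hd : 2 ≤ φ.natDegree) (n : ℕ) (hn : 1 ≤ n) :
    (φ.comp^[n] X - X).natDegree = φ.natDegree ^ n ∧ 2 ≤ φ.natDegree ^ n := by
  have h2 : 2 ≤ φ.natDegree ^ n := hd.trans (Nat.le_self_pow (by omega) _)
  refine ⟨?_, h2⟩
  rw [natDegree_sub_eq_left_of_natDegree_lt, bk_it]
  rw [bk_it, natDegree_X]; omega

lemma bk_root {K : Type*} [Field K] (φ : K[X]) (hd : 2 ≤ φ.natDegree) (n : ℕ) (hn : 1 ≤ n) (x : K) :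
    x ∈ (φ.comp^[n] X - X).roots ↔ (fun z => φ.eval z)^[n] x = x := by
  have h := bk_itA φ hd n hn
  rw [mem_roots (by intro h0; rw [h0] at h; simp at h; omega), IsRoot, eval_sub, iterate_comp_eval,
    eval_X, sub_eq_zero]

lemma bk_der_deg {K : Type*} [Field K] [CharZero K] (φ : K[X]) :
    (derivative φ).natDegree = φ.natDegree - 1 := by
  exact natDegree_derivative φ

/-- lower bound for the number of fixed points of the iterate -/
lemma bk_lower {K : Type*} [Field K] [IsAlgClosed K] [CharZero K] [DecidableEq K] (φ : K[X])
    (hd : 2 ≤ φ.natDegree) (n : ℕ) :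
    φ.natDegree ^ n ≤ (φ.comp^[n + 1] X - X).roots.toFinset.card := by
  obtain ⟨hA, hD⟩ := bk_itA φ hd (n + 1) (by omega)
  have hA0 : φ.comp^[n + 1] X - X ≠ 0 := by intro h; rw [h] at hA; simp at hA; omega
  obtain ⟨G, hG0, hG, hG', hdeg⟩ := bk_exists_G _ hA0
  obtain ⟨c, hc⟩ := IsAlgClosed.exists_root (derivative φ) (by
    have h1 := bk_der_deg φ
    intro h
    have h2 := natDegree_eq_zero_iff_degree_le_zero.mpr h.le
    omega)
  have hQ : φ.comp^[n + 1] X = φ.comp (φ.comp^[n] X) := iterate_succ_apply' _ _ _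
  obtain ⟨b1, b2⟩ := bk_comp_dvd φ (φ.comp^[n] X) (X - C c) c
    (by rw [dvd_iff_isRoot]; simp) (by rwa [dvd_iff_isRoot])
  rw [← hQ] at b1 b2
  have hk := bk_key _ G _ _ hG hG' b1 b2
  have hW := bk_W (φ.comp^[n + 1] X - X) (by omega) (φ.eval c)
  have hW0 : derivative (φ.comp^[n + 1] X - X) * (X - C (φ.eval c)) - (φ.comp^[n + 1] X - X) ≠ 0 :=
    ne_zero_of_natDegree_gt (n := 0) (by rw [hW.1]; omega)
  have := natDegree_le_of_dvd hk hW0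
  have hB : ((X - C c).comp (φ.comp^[n] X)).natDegree = φ.natDegree ^ n := by
    rw [natDegree_comp, bk_it]; simp
  rw [natDegree_mul hG0 (by
    intro h; rw [h, natDegree_zero] at hB; have := pow_pos (by omega : 0 < φ.natDegree) n; omega), hB] at this
  omega

/-- upper bound -/
lemma bk_upper {K : Type*} [Field K] [DecidableEq K] (φ : K[X])
    (hd : 2 ≤ φ.natDegree) (n : ℕ) (hn : 1 ≤ n)
    (hno : ∀ x, minimalPeriod (fun z => φ.eval z) x ≠ n) :
    (φ.comp^[n] X - X).roots.toFinset.card ≤ ∑ k ∈ n.properDivisors, φ.natDegree ^ k := by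
  have hsub : (φ.comp^[n] X - X).roots.toFinset ⊆
      n.properDivisors.biUnion fun k => (φ.comp^[k] X - X).roots.toFinset := by
    intro x hx
    rw [Multiset.mem_toFinset, bk_root φ hd n hn] at hx
    have hp : IsPeriodicPt (fun z => φ.eval z) n x := hx
    have h1 := hp.minimalPeriod_dvd
    have h2 := hp.minimalPeriod_pos hn
    have h3 := Nat.le_of_dvd hn h1
    rw [Finset.mem_biUnion]
    refine ⟨_, Nat.mem_properDivisors.mpr ⟨h1, lt_of_le_of_ne h3 (hno x)⟩, ?_⟩
    rw [Multiset.mem_toFinset, bk_root φ hd _ h2]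
    exact iterate_minimalPeriod
  refine (Finset.card_le_card hsub).trans (Finset.card_biUnion_le.trans ?_)
  refine Finset.sum_le_sum fun k hk => ?_
  have hk1 : 1 ≤ k := Nat.pos_of_mem_properDivisors hk
  rw [← (bk_itA φ hd k hk1).1]
  exact (Multiset.toFinset_card_le _).trans (card_roots' _)

lemma bk_ge3 {K : Type*} [Field K] [IsAlgClosed K] [CharZero K] (φ : K[X])
    (hd : 2 ≤ φ.natDegree) (n : ℕ) (hn : 3 ≤ n) :
    ∃ x, minimalPeriod (fun z => φ.eval z) x = n := by
  classical
  by_contra! hno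
  have h1 := bk_upper φ hd n (by omega) hno
  obtain ⟨m, rfl⟩ : ∃ m, n = m + 1 := ⟨n - 1, by omega⟩
  have h2 := bk_lower φ hd m
  have h3 : ∑ k ∈ (m + 1).properDivisors, φ.natDegree ^ k < φ.natDegree ^ m := by
    apply Nat.geomSum_lt hd
    intro k hk
    obtain ⟨⟨q, hq⟩, hlt⟩ := Nat.mem_properDivisors.mp hk
    rcases q with _ | _ | q
    · omega
    · omega
    · by_contra! h
      have : k * 2 ≤ k * (q + 1 + 1) := Nat.mul_le_mul_left _ (by omega)
      omega
  omega

lemma bk_two {K : Type*} [Field K] [IsAlgClosed K] [CharZero K] (φ : K[X])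
    (hd : 3 ≤ φ.natDegree) :
    ∃ x, minimalPeriod (fun z => φ.eval z) x = 2 := by
  classical
  by_contra! hno
  have h1 := bk_upper φ (by omega) 2 (by omega) hno
  rw [show Nat.properDivisors 2 = {1} by decide, Finset.sum_singleton, pow_one] at h1
  obtain ⟨hA, hD⟩ := bk_itA φ (by omega) 2 (by omega)
  have hQ : φ.comp^[2] X = φ.comp φ := by simp
  rw [hQ] at h1 hA
  set d := φ.natDegree with hddef
  set A := φ.comp φ - X with hAdef
  have hA0 : A ≠ 0 := by intro h; rw [h] at hA; simp at hA; omega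
  obtain ⟨G, hG0, hG, hG', hdeg⟩ := bk_exists_G A hA0
  have hW : ∀ a, _ := fun a => bk_W A (by omega) a
  have hW0 : ∀ a, derivative A * (X - C a) - A ≠ 0 := by
    intro a h; have := hW a; rw [h] at this; simp at this; omega
  have hdd : d ^ 2 = d * d := sq d
  -- the two critical points
  have hcard : Multiset.card (derivative φ).roots = d - 1 := by
    rw [← (IsAlgClosed.splits _).natDegree_eq_card_roots, bk_der_deg]
  obtain ⟨c1, hc1⟩ := Multiset.card_pos_iff_exists_mem.mp
    (by omega : 0 < Multiset.card (derivative φ).roots)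
  obtain ⟨t1, ht1⟩ := Multiset.exists_cons_of_mem hc1
  rw [ht1, Multiset.card_cons] at hcard
  obtain ⟨c2, hc2⟩ := Multiset.card_pos_iff_exists_mem.mp (by omega : 0 < Multiset.card t1)
  obtain ⟨t2, rfl⟩ := Multiset.exists_cons_of_mem hc2
  have hprod : (X - C c1) * (X - C c2) ∣ derivative φ := by
    have h := (IsAlgClosed.splits (derivative φ)).eq_prod_roots
    rw [ht1, Multiset.map_cons, Multiset.map_cons, Multiset.prod_cons, Multiset.prod_cons] at h
    rw [h]
    exact Dvd.intro _ (by ring : (X - C c1) * (X - C c2) * (C (derivative φ).leadingCoeff *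
      (Multiset.map (fun x => X - C x) t2).prod) = _)
  by_cases hc : c1 = c2
  · subst hc
    have hr : (X - C c1) * (X - C c1) ∣ φ - C (φ.eval c1) := by
      obtain ⟨S, hS⟩ := (dvd_iff_isRoot (p := φ - C (φ.eval c1)) (a := c1)).mpr (by simp)
      have h' : derivative φ = S + (X - C c1) * derivative S := by
        have := congrArg derivative hS
        simpa using this
      have : X - C c1 ∣ S := by
        rw [← (dvd_add_left (dvd_mul_right (X - C c1) (derivative S))), ← h']
        exact (dvd_mul_right _ _).trans hprod
      rw [hS]
      exact mul_dvd_mul_left _ this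
    obtain ⟨b1, b2⟩ := bk_comp_dvd φ φ _ c1 hr hprod
    have hk := natDegree_le_of_dvd (bk_key _ G _ _ hG hG' b1 b2) (hW0 _)
    have hB : (((X - C c1) * (X - C c1)).comp φ).natDegree = 2 * d := by
      rw [natDegree_comp, natDegree_mul (X_sub_C_ne_zero _) (X_sub_C_ne_zero _)]; simp [hddef]
    rw [natDegree_mul hG0 (by intro h; rw [h] at hB; simp at hB; omega), hB, (hW _).1] at hk
    omega
  · have hmain : ∀ c, X - C c ∣ derivative φ → G.natDegree + d = d ^ 2 ∧ ∃ k : K,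
        derivative A * (X - C (φ.eval c)) - A = G * (φ - C c) * C k ∧
        G.leadingCoeff * φ.leadingCoeff * k = ((A.natDegree : K) - 1) * A.leadingCoeff := by
      intro c hcd
      obtain ⟨b1, b2⟩ := bk_comp_dvd φ φ _ c (by rw [dvd_iff_isRoot]; simp) hcd
      have hk := bk_key _ G _ _ hG hG' b1 b2
      rw [sub_comp, X_comp, C_comp] at hk
      obtain ⟨E, hE⟩ := hk
      have hB : (φ - C c).natDegree = d := natDegree_sub_C
      have hB0 : φ - C c ≠ 0 := by intro h; rw [h] at hB; simp at hB; omega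
      have hE0 : E ≠ 0 := by rintro rfl; rw [mul_zero] at hE; exact hW0 _ hE
      have hn := congrArg natDegree hE
      rw [(hW _).1, natDegree_mul (mul_ne_zero hG0 hB0) hE0, natDegree_mul hG0 hB0, hB] at hn
      have hEd : E.natDegree = 0 := by omega
      refine ⟨by omega, E.coeff 0, ?_, ?_⟩
      · rw [← eq_C_of_natDegree_eq_zero hEd]; exact hE
      · have hl := congrArg leadingCoeff hE
        rw [(hW _).2, leadingCoeff_mul, leadingCoeff_mul] at hl
        rw [hl]
        congr 1
        · congr 1
          rw [leadingCoeff, leadingCoeff, hB, ← hddef, coeff_sub, coeff_C,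
            if_neg (by omega), sub_zero]
        · rw [leadingCoeff, hEd]
    obtain ⟨hGd, k1, e1, l1⟩ := hmain c1 ((dvd_mul_right _ _).trans hprod)
    obtain ⟨-, k2, e2, l2⟩ := hmain c2 ((dvd_mul_left _ _).trans hprod)
    have hφ0 : φ ≠ 0 := by intro h; rw [h] at hddef; simp at hddef; omega
    have hkk : k1 = k2 := by
      refine mul_left_cancel₀ (mul_ne_zero (leadingCoeff_ne_zero.mpr hG0)
        (leadingCoeff_ne_zero.mpr hφ0)) (l1.trans l2.symm)
    subst hkk
    have hk0 : k1 ≠ 0 := by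
      rintro rfl
      rw [C_0, mul_zero] at e1
      exact hW0 _ e1
    have hfin : C (φ.eval c2 - φ.eval c1) * derivative A = G * C (k1 * (c2 - c1)) := by
      simp only [C_sub, C_mul]
      linear_combination e1 - e2
    have hne : k1 * (c2 - c1) ≠ 0 := mul_ne_zero hk0 (sub_ne_zero.mpr (Ne.symm hc))
    by_cases ha : φ.eval c2 - φ.eval c1 = 0
    · rw [ha, C_0, zero_mul] at hfin
      exact mul_ne_zero hG0 (C_ne_zero.mpr hne) hfin.symm
    · have := congrArg natDegree hfin
      rw [natDegree_C_mul ha, natDegree_mul_C hne, bk_der_deg, hA] at this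
      omega

lemma bk_one {K : Type*} [Field K] [IsAlgClosed K] (φ : K[X])
    (hd : 2 ≤ φ.natDegree) : ∃ x, φ.eval x = x := by
  have h := (bk_itA φ hd 1 le_rfl).1
  simp only [iterate_one, comp_X, pow_one] at h
  obtain ⟨x, hx⟩ := IsAlgClosed.exists_root (φ - X) (by
    intro h'
    have h2 := natDegree_eq_zero_iff_degree_le_zero.mpr h'.le
    omega)
  exact ⟨x, by simpa [sub_eq_zero] using hx⟩

lemma bk_minper_two {K : Type*} {f : K → K} {x : K} (h1 : f x ≠ x) (h2 : f (f x) = x) :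
    minimalPeriod f x = 2 := by
  have hp : IsPeriodicPt f 2 x := h2
  have h3 := hp.minimalPeriod_dvd
  rcases (Nat.dvd_prime Nat.prime_two).mp h3 with h | h
  · exact absurd (minimalPeriod_eq_one_iff_isFixedPt.mp h) h1
  · exact h

lemma bk_quad {K : Type*} [Field K] [IsAlgClosed K] [CharZero K] (φ : K[X])
    (hd : φ.natDegree = 2) (hc : ¬ LinConj φ (X ^ 2 - C (3 / 4 : K))) :
    ∃ x, minimalPeriod (fun z => φ.eval z) x = 2 := by
  have hα : φ.coeff 2 ≠ 0 := by
    rw [← hd]; exact leadingCoeff_ne_zero.mpr (ne_zero_of_natDegree_gt (n := 0) (by omega))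
  have hev : ∀ z, φ.eval z = φ.coeff 0 + φ.coeff 1 * z + φ.coeff 2 * z ^ 2 := by
    intro z
    rw [eval_eq_sum_range, hd]
    simp [Finset.sum_range_succ]
  generalize φ.coeff 2 = α at *
  generalize φ.coeff 1 = β at *
  generalize φ.coeff 0 = γ at *
  obtain ⟨c, hcdef⟩ : ∃ c, c = α * (γ - β ^ 2 / (4 * α) + β / (2 * α)) := ⟨_, rfl⟩
  have hconj : ∀ z, φ.eval (α⁻¹ * z + (-β / (2 * α))) = α⁻¹ * (z ^ 2 + c) + (-β / (2 * α)) := by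
    intro z
    rw [hev, hcdef]
    field_simp
    ring
  have hc34 : c ≠ -(3 / 4) := by
    rintro rfl
    refine hc ⟨α⁻¹, -β / (2 * α), inv_ne_zero hα, fun z => ?_⟩
    rw [hconj]
    simp [sub_eq_add_neg]
  obtain ⟨s, hs⟩ := IsAlgClosed.exists_pow_nat_eq (1 - 4 * (c + 1)) (n := 2) (by norm_num)
  have hw : ((s - 1) / 2) ^ 2 + (s - 1) / 2 + c + 1 = 0 := by
    linear_combination hs / 4
  generalize (s - 1) / 2 = w at hw
  have e1 : w ^ 2 + c = -w - 1 := by linear_combination hw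
  have e2 : (-w - 1) ^ 2 + c = w := by linear_combination hw
  refine ⟨α⁻¹ * w + (-β / (2 * α)), bk_minper_two ?_ ?_⟩
  · show φ.eval _ ≠ _
    rw [hconj, e1]
    intro h
    have h' := mul_left_cancel₀ (inv_ne_zero hα) (add_right_cancel h)
    have hw2 : w = -(1 / 2) := by linear_combination -h' / 2
    apply hc34
    rw [hw2] at hw
    linear_combination hw
  · show φ.eval (φ.eval _) = _
    rw [hconj, e1, hconj, e2]

lemma bk_no_two {K : Type*} [Field K] [CharZero K] (φ : K[X])
    (hc : LinConj φ (X ^ 2 - C (3 / 4 : K))) (x : K) (hx : φ.eval (φ.eval x) = x) :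
    φ.eval x = x := by
  obtain ⟨a, b, ha, h⟩ := hc
  obtain ⟨z, rfl⟩ : ∃ z, x = a * z + b := ⟨(x - b) / a, by field_simp; ring⟩
  rw [← h, ← h] at hx
  have h1 := mul_left_cancel₀ ha (add_right_cancel hx)
  rw [← h]
  simp only [eval_sub, eval_pow, eval_X, eval_C] at h1 ⊢
  have h2 : (z - 3 / 2) * (z + 1 / 2) ^ 3 = 0 := by linear_combination h1
  have h3 : z = 3 / 2 ∨ z = -(1 / 2) := by
    rcases mul_eq_zero.mp h2 with h | h
    · left; linear_combination h
    · right; have := pow_eq_zero_iff (by norm_num) |>.mp h; linear_combination this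
  rcases h3 with rfl | rfl <;> congr 2 <;> norm_num

lemma bk_surj {K : Type*} [Field K] [IsAlgClosed K] (φ : K[X])
    (hd : 2 ≤ φ.natDegree) (y : K) : ∃ x, φ.eval x = y := by
  have h : (φ - C y).natDegree = φ.natDegree := natDegree_sub_C
  obtain ⟨x, hx⟩ := IsAlgClosed.exists_root (φ - C y) (by
    intro h'
    have h2 := natDegree_eq_zero_iff_degree_le_zero.mpr h'.le
    omega)
  exact ⟨x, by simpa [sub_eq_zero] using hx⟩

lemma bk_single {K : Type*} [Field K] [IsAlgClosed K] (P : K[X]) (p : K)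
    (h : ∀ x, P.eval x = 0 → x = p) : P = C P.leadingCoeff * (X - C p) ^ P.natDegree := by
  by_cases h0 : P = 0
  · simp [h0]
  have hr : P.roots = Multiset.replicate P.natDegree p := by
    rw [Multiset.eq_replicate]
    refine ⟨(IsAlgClosed.splits P).natDegree_eq_card_roots.symm, fun b hb => h b ?_⟩
    exact (mem_roots h0).mp hb
  conv_lhs => rw [(IsAlgClosed.splits P).eq_prod_roots, hr]
  simp

lemma bk_two_pre {K : Type*} [Field K] [IsAlgClosed K] [CharZero K] (φ : K[X])
    (hd : 2 ≤ φ.natDegree) (y1 y2 p1 p2 : K) (hy : y1 ≠ y2) (hp1 : φ.eval p1 = y1)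
    (h1 : ∀ x, φ.eval x = y1 → x = p1) (h2 : ∀ x, φ.eval x = y2 → x = p2) : False := by
  have e1 := bk_single (φ - C y1) p1 (fun x hx => h1 x (by simpa [sub_eq_zero] using hx))
  have e2 := bk_single (φ - C y2) p2 (fun x hx => h2 x (by simpa [sub_eq_zero] using hx))
  obtain ⟨p2', hp2⟩ := bk_surj φ hd y2
  obtain rfl := h2 _ hp2
  have hne : p1 ≠ p2' := by rintro rfl; exact hy (hp1.symm.trans hp2)
  rw [natDegree_sub_C] at e1 e2
  have d1 := congrArg (fun P => (derivative P).eval p1) e1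
  have d2 := congrArg (fun P => (derivative P).eval p1) e2
  have hl : (φ - C y2).leadingCoeff ≠ 0 := leadingCoeff_ne_zero.mpr
    (ne_zero_of_natDegree_gt (n := 0) (by rw [natDegree_sub_C]; omega))
  simp [derivative_X_sub_C_pow] at d1 d2
  rw [zero_pow (by omega)] at d1
  rw [d1] at d2
  simp at d2
  rcases d2 with d2 | d2 | d2
  · exact hl (by rw [d2]; simp)
  · omega
  · exact hne (sub_eq_zero.mp d2.1)

lemma bk_pre {K : Type*} [Field K] [IsAlgClosed K] [CharZero K] (φ : K[X])
    (hd : 2 ≤ φ.natDegree) (N : ℕ) (hN : 1 ≤ N) (x : K)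
    (hx : minimalPeriod (fun z => φ.eval z) x = N) :
    ∃ y, y ∉ periodicPts (fun z => φ.eval z) ∧
      minimalPeriod (fun z => φ.eval z) (φ.eval y) = N := by
  set f : K → K := fun z => φ.eval z with hf
  have hper : ∀ u, minimalPeriod f u = N → ∀ y, f y = u → y ≠ f^[N - 1] u → y ∉ periodicPts f := by
    rintro u hu y rfl hne hy
    apply hne
    rw [minimalPeriod_apply hy] at hu
    rw [← iterate_succ_apply, show (N - 1).succ = N by omega, ← hu, iterate_minimalPeriod]
  by_contra! hno
  have huniq : ∀ u, minimalPeriod f u = N → ∀ y, f y = u → y = f^[N - 1] u := by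
    intro u hu y hy
    by_contra hne
    exact hno y (hper u hu y hy hne) (by rw [← hu, ← hy])
  -- any two points of period `N` coincide
  have hall : ∀ u v, minimalPeriod f u = N → minimalPeriod f v = N → u = v := by
    intro u v hu hv
    by_contra hne
    obtain ⟨p, hp⟩ := bk_surj φ hd u
    have hp' := huniq u hu p hp
    exact bk_two_pre φ hd u v p _ hne hp (fun y hy => by rw [hp']; exact huniq u hu y hy)
      (huniq v hv)
  have hfx : f x = x := by
    refine hall _ _ ?_ hx
    rw [minimalPeriod_apply (minimalPeriod_pos_iff_mem_periodicPts.mp (by omega)), hx]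
  have hN1 : N = 1 := by rw [← hx]; exact minimalPeriod_eq_one_iff_isFixedPt.mpr hfx
  subst hN1
  have hdeg := (bk_itA φ hd 1 le_rfl).1
  simp only [iterate_one, comp_X, pow_one] at hdeg
  have e := bk_single (φ - X) x (fun y hy => hall _ _ (minimalPeriod_eq_one_iff_isFixedPt.mpr
    (show φ.eval y = y by simpa [sub_eq_zero] using hy)) hx)
  have hl : (φ - X).leadingCoeff ≠ 0 := leadingCoeff_ne_zero.mpr
    (ne_zero_of_natDegree_gt (n := 0) (by omega))
  rw [hdeg] at e
  generalize (φ - X).leadingCoeff = α at *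
  obtain ⟨w, hw⟩ := IsAlgClosed.exists_pow_nat_eq (-α⁻¹) (n := φ.natDegree - 1) (by omega)
  have hw0 : w ≠ 0 := by
    rintro rfl
    rw [zero_pow (by omega)] at hw
    exact inv_ne_zero hl (by linear_combination hw)
  have hpow : w ^ φ.natDegree = w * (-α⁻¹) := by
    rw [← hw, ← pow_succ', Nat.sub_one_add_one (by omega)]
  have he := congrArg (Polynomial.eval (x + w)) e
  simp only [eval_sub, eval_X, eval_mul, eval_C, eval_pow, add_sub_cancel_left, hpow] at he
  have hfw : f (x + w) = x := by
    show φ.eval (x + w) = x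
    have : α * α⁻¹ = 1 := mul_inv_cancel₀ hl
    linear_combination he - w * this
  have := huniq x hx _ hfw
  simp at this
  exact hw0 this

lemma bk_portrait_zero {K : Type*} (f : K → K) (x : K) (N : ℕ) (hN : 1 ≤ N)
    (hx : minimalPeriod f x = N) : Portrait f x 0 N := by
  refine ⟨hN, ?_, fun _ _ _ _ => Nat.zero_le _, fun n hn h => ?_⟩
  · rw [zero_add, ← hx]; exact iterate_minimalPeriod
  · rw [zero_add] at h
    rw [← hx]
    exact IsPeriodicPt.minimalPeriod_le hn h

lemma bk_portrait_succ {K : Type*} (f : K → K) (x y : K) (M N : ℕ) (hN : 1 ≤ N)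
    (hx : x ∉ periodicPts f) (hfx : minimalPeriod f (f x) = N) (hy : f^[M] y = x) :
    Portrait f y (M + 1) N := by
  have h1 : f^[M + 1] y = f x := by rw [iterate_succ_apply', hy]
  have h2 : ∀ n, f^[M + 1 + n] y = f^[n] (f x) := by
    intro n; rw [add_comm, iterate_add_apply, h1]
  refine ⟨hN, ?_, fun m n hn h => ?_, fun n hn h => ?_⟩
  · rw [h2, h1, ← hfx]; exact iterate_minimalPeriod
  · by_contra! hlt
    apply hx
    refine ⟨n, hn, ?_⟩
    show f^[n] x = x
    have := congrArg f^[M - m] h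
    rw [← iterate_add_apply, ← iterate_add_apply, show M - m + (m + n) = n + M by omega,
      show M - m + m = M by omega, iterate_add_apply, hy] at this
    exact this
  · rw [h2, h1] at h
    rw [← hfx]
    exact IsPeriodicPt.minimalPeriod_le hn h

lemma bk_all {K : Type*} [Field K] [IsAlgClosed K] [CharZero K] (φ : K[X])
    (hd : 2 ≤ φ.natDegree) (M N : ℕ) (hN : 1 ≤ N)
    (h : ∃ x, minimalPeriod (fun z => φ.eval z) x = N) :
    ∃ x : K, Portrait (fun z => φ.eval z) x M N := by
  obtain ⟨x, hx⟩ := h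
  rcases M with _ | M
  · exact ⟨x, bk_portrait_zero _ x N hN hx⟩
  · obtain ⟨y, hy, hy'⟩ := bk_pre φ hd N hN x hx
    have hs : Surjective (fun z => φ.eval z) := bk_surj φ hd
    obtain ⟨z, hz⟩ := hs.iterate M y
    exact ⟨z, bk_portrait_succ _ y z M N hN hy hy' hz⟩

/-- A polynomial `φ` of degree `d ≥ 2` admits a point of portrait `(M,N)` for all
`M ≥ 0`, `N ≥ 1`, unless `φ` is linearly conjugate to `z² - 3/4`, in which case it admits a
point of portrait `(M,N)` iff `N ≠ 2`. -/
theorem baker_portraits (K : Type*) [Field K] [IsAlgClosed K] [CharZero K]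
    (φ : Polynomial K) (hdeg : 2 ≤ φ.natDegree) (M N : ℕ) (hN : 1 ≤ N) :
    (¬ LinConj φ (X ^ 2 - C (3 / 4 : K)) →
      ∃ x : K, Portrait (fun z => φ.eval z) x M N) ∧
    (LinConj φ (X ^ 2 - C (3 / 4 : K)) →
      ((∃ x : K, Portrait (fun z => φ.eval z) x M N) ↔ N ≠ 2)) := by
  have hper : N ≠ 2 → ∃ x : K, Portrait (fun z => φ.eval z) x M N := by
    intro h2
    apply bk_all φ hdeg M N hN
    rcases (by omega : N = 1 ∨ 3 ≤ N) with rfl | h3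
    · obtain ⟨x, hx⟩ := bk_one φ hdeg
      exact ⟨x, minimalPeriod_eq_one_iff_isFixedPt.mpr hx⟩
    · exact bk_ge3 φ hdeg N h3
  refine ⟨fun hc => ?_, fun hc => ⟨?_, hper⟩⟩
  · by_cases h2 : N = 2
    · subst h2
      apply bk_all φ hdeg M 2 hN
      rcases (by omega : φ.natDegree = 2 ∨ 3 ≤ φ.natDegree) with h | h
      · exact bk_quad φ h hc
      · exact bk_two φ h
    · exact hper h2
  · rintro ⟨x, -, h1, -, h3⟩ rfl
    have hfix := bk_no_two φ hc ((fun z => φ.eval z)^[M] x) (by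
      rw [iterate_succ_apply', iterate_succ_apply'] at h1
      exact h1)
    have := h3 1 one_pos (by rw [iterate_succ_apply']; exact hfix)
    omega
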